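/- arXiv:math/0106232 — 2 statements merged into one kernel-verified Lean document; each statement's English description precedes it below -/
import Mathlib

section
/- Let q > 2 be a prime power. For a subset S ⊆ 𝔽_q let n_S be the number of functions f : 𝔽_q → S with ∑_{c ∈ 𝔽_q} c·f(c) = 0, and let N be the number of permutations σ of 𝔽_q with deg(f_σ) < q−2. Then N = ∑_{S ⊆ 𝔽_q} (−1)^{q−|S|} n_S. -/
open Finset Polynomial

/-- The permutation polynomial of a permutation `σ` of a finite field:
`f_σ(x) = ∑_{c} σ(c) (1 - (x - c)^(q-1))`. -/
noncomputable def permPoly {F : Type*} [Field F] [Fintype F] (σ : Equiv.Perm F) : Polynomial F :=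
  ∑ c : F, Polynomial.C (σ c) * (1 - (Polynomial.X - Polynomial.C c) ^ (Fintype.card F - 1))

/-- `n_S`: the number of functions `f : 𝔽_q → S` with `∑ c, c * f c = 0`. -/
noncomputable def nS {F : Type*} [Field F] [Fintype F] (S : Finset F) : ℕ :=
  Nat.card {f : F → F // (∀ c, f c ∈ S) ∧ ∑ c : F, c * f c = 0}

theorem permPoly_degree_lt_iff {F : Type*} [Field F] [Fintype F]
    (h2 : 2 < Fintype.card F) (σ : Equiv.Perm F) :
    (permPoly σ).degree < ((Fintype.card F - 2 : ℕ) : WithBot ℕ) ↔ ∑ c : F, c * σ c = 0 := by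
  classical
  obtain ⟨m, hm⟩ : ∃ m, Fintype.card F = m + 3 := ⟨Fintype.card F - 3, by omega⟩
  have hcoeff : ∀ k, 0 < k → (permPoly σ).coeff k =
      ∑ c : F, σ c * (-((-c) ^ (m + 2 - k) * ((m + 2).choose k : F))) := by
    intro k hk
    unfold permPoly
    rw [Polynomial.finsetSum_coeff]
    refine Finset.sum_congr rfl fun c _ => ?_
    rw [Polynomial.coeff_C_mul, Polynomial.coeff_sub, sub_eq_add_neg Polynomial.X, ← Polynomial.C_neg,
      Polynomial.coeff_X_add_C_pow,
      Polynomial.coeff_one, if_neg (by omega), hm]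
    simp
  have hsum : ∑ c : F, σ c = 0 := by
    rw [Equiv.sum_comp σ (fun x => x)]
    have := FiniteField.sum_pow_lt_card_sub_one F 1 (by omega)
    simpa using this
  have hcast : ((m + 2 : ℕ) : F) = -1 := by
    have h : ((Fintype.card F : ℕ) : F) = 0 := Nat.cast_card_eq_zero F
    rw [hm] at h
    push_cast at h ⊢
    linear_combination h
  have hm1 : (permPoly σ).coeff (m + 1) = - ∑ c : F, c * σ c := by
    rw [hcoeff _ (by omega), ← Finset.sum_neg_distrib]
    refine Finset.sum_congr rfl fun c _ => ?_
    have : (m + 2).choose (m + 1) = m + 2 := Nat.choose_succ_self_right (m + 1)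
    rw [this, hcast, show m + 2 - (m + 1) = 1 by omega]
    ring
  have hm2 : (permPoly σ).coeff (m + 2) = 0 := by
    rw [hcoeff _ (by omega)]
    simp [hsum]
  have hbig : ∀ k, m + 2 < k → (permPoly σ).coeff k = 0 := by
    intro k hk
    rw [hcoeff _ (by omega)]
    simp [Nat.choose_eq_zero_of_lt hk]
  rw [hm, show m + 3 - 2 = m + 1 by omega, Polynomial.degree_lt_iff_coeff_zero]
  constructor
  · intro h
    have := h (m + 1) le_rfl
    rw [hm1] at this
    simpa using this
  · intro h k hk
    rcases Nat.lt_or_ge (m + 2) k with h1 | h1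
    · exact hbig k h1
    · obtain rfl | rfl : k = m + 1 ∨ k = m + 2 := by omega
      · rw [hm1, h, neg_zero]
      · exact hm2

theorem sum_supersets {F : Type*} [Fintype F] [DecidableEq F] (T : Finset F) :
    ∑ S : Finset F, (if T ⊆ S then (-1 : ℤ) ^ (Fintype.card F - S.card) else 0) =
      if T = univ then 1 else 0 := by
  rw [← Equiv.sum_comp (Function.Involutive.toPerm (compl : Finset F → Finset F) compl_involutive)]
  have h := Finset.sum_powerset_neg_one_pow_card (x := Tᶜ)
  simp only [Finset.compl_eq_empty_iff] at h
  have hfil : Tᶜ.powerset = univ.filter (fun S : Finset F => T ⊆ Sᶜ) := by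
    ext S
    simp only [mem_filter, mem_univ, true_and, mem_powerset]
    exact subset_compl_comm
  rw [hfil, Finset.sum_filter] at h
  refine Eq.trans (Finset.sum_congr rfl fun S _ => ?_) h
  simp only [Function.Involutive.coe_toPerm]
  rw [← Finset.card_compl, compl_compl]
  congr

theorem N_eq_alternating_sum (F : Type*) [Field F] [Fintype F] [DecidableEq F]
    (q : ℕ) (hq : q = Fintype.card F) (hq2 : 2 < q)
    (N : ℕ)
    (hN : N = Nat.card {σ : Equiv.Perm F // (permPoly σ).degree < ((q - 2 : ℕ) : WithBot ℕ)}) :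
    (N : ℤ) = ∑ S : Finset F, (-1) ^ (q - S.card) * (nS S : ℤ) := by
  subst hq
  have hn : ∀ S : Finset F, (nS S : ℤ) = ∑ f : F → F,
      if (∑ c : F, c * f c = 0) then (if univ.image f ⊆ S then 1 else 0) else 0 := by
    intro S
    unfold nS
    rw [Nat.card_eq_fintype_card, Fintype.card_subtype, Finset.card_filter]
    push_cast
    refine Finset.sum_congr rfl fun f _ => ?_
    have : (univ.image f ⊆ S) ↔ ∀ c, f c ∈ S := by simp [Finset.image_subset_iff]
    simp only [this, ← ite_and]
    exact if_congr and_comm rfl rfl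
  have hN' : (N : ℤ) = ∑ f : F → F,
      if (∑ c : F, c * f c = 0) then (if univ.image f = univ then 1 else 0) else 0 := by
    have e : {σ : Equiv.Perm F // (permPoly σ).degree < ((Fintype.card F - 2 : ℕ) : WithBot ℕ)} ≃
        {f : F → F // (∑ c : F, c * f c = 0) ∧ univ.image f = univ} := by
      refine Equiv.ofBijective (fun σ => ⟨σ.1, (permPoly_degree_lt_iff hq2 σ.1).1 σ.2,
        Finset.image_univ_of_surjective σ.1.surjective⟩) ⟨?_, ?_⟩
      · intro a b h
        exact Subtype.ext (DFunLike.coe_injective (congrArg Subtype.val h))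
      · rintro ⟨f, h1, h2⟩
        have hs : Function.Surjective f := by
          intro y
          have hy : y ∈ univ.image f := by
            rw [h2]
            exact Finset.mem_univ y
          simpa using hy
        refine ⟨⟨Equiv.ofBijective f (Finite.surjective_iff_bijective.1 hs), ?_⟩, ?_⟩
        · rw [permPoly_degree_lt_iff hq2]
          simpa using h1
        · rfl
    rw [hN, Nat.card_congr e, Nat.card_eq_fintype_card, Fintype.card_subtype, Finset.card_filter]
    push_cast
    exact Finset.sum_congr rfl fun f _ => ite_and _ _ _ _
  rw [hN']
  simp_rw [hn, Finset.mul_sum]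
  rw [Finset.sum_comm]
  refine Finset.sum_congr rfl fun f _ => ?_
  split_ifs with h1 h2
  · simpa [h2] using (sum_supersets (univ.image f)).symm
  · simpa [h2] using (sum_supersets (univ.image f)).symm
  · simp
end

section
/- Let q = p^f > 2 be a prime power, e_p(u) = e^{2πiu/p}, Tr the absolute trace from 𝔽_q to 𝔽_p, and N the number of permutations σ of 𝔽_q with deg(f_σ) < q−2. Then N − (q−1)! = ((q−1)/q) · ∑_{S ⊆ 𝔽_q} (−1)^{q−|S|} |S| · ∏_{b ∈ 𝔽_q^*} ∑_{t ∈ S} e_p(Tr(bt)). -/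
open Finset Polynomial

/-- `e_p(u) = exp(2πiu/p)` for `u : ZMod p`. -/
noncomputable def ep (p : ℕ) (u : ZMod p) : ℂ :=
  Complex.exp (2 * Real.pi * Complex.I * (u.val : ℂ) / p)

/-- The absolute trace `Tr : 𝔽_q → 𝔽_p`. -/
noncomputable def absTrace {F : Type*} [Field F] [Fintype F] (p : ℕ) [CharP F p] (x : F) :
    ZMod p :=
  letI := ZMod.algebra F p
  Algebra.trace (ZMod p) F x

section helpers

theorem ryser_aux {F : Type*} [Fintype F] [DecidableEq F] (I : Finset F) :
    ∑ S : Finset F, (if I ⊆ S then (-1 : ℂ) ^ (Fintype.card F - S.card) else 0)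
      = if I = univ then 1 else 0 := by
  have h1 : ∑ S : Finset F, (if I ⊆ S then (-1 : ℂ) ^ (Fintype.card F - S.card) else 0)
      = ∑ T : Finset F, (if T ⊆ Iᶜ then (-1 : ℂ) ^ T.card else 0) := by
    refine Finset.sum_nbij' (fun S => Sᶜ) (fun S => Sᶜ) ?_ ?_ ?_ ?_ ?_
    · simp
    · simp
    · simp
    · simp
    · intro S _
      simp only [Finset.compl_subset_compl, Finset.card_compl]
  rw [h1, ← Finset.sum_filter]
  have h2 : (univ.filter fun T : Finset F => T ⊆ Iᶜ) = (Iᶜ).powerset := by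
    ext T; simp
  rw [h2]
  have h3 := Finset.sum_powerset_neg_one_pow_card (x := Iᶜ)
  have h4 := congrArg (Int.cast : ℤ → ℂ) h3
  push_cast at h4
  rw [h4]
  simp [Finset.compl_eq_empty_iff]

theorem ryser {F : Type*} [Fintype F] [DecidableEq F] (M : F → F → ℂ) :
    ∑ S : Finset F, (-1 : ℂ) ^ (Fintype.card F - S.card) * ∏ c, ∑ t ∈ S, M c t
      = ∑ σ : Equiv.Perm F, ∏ c, M c (σ c) := by
  have h1 : ∀ S : Finset F, (-1 : ℂ) ^ (Fintype.card F - S.card) * ∏ c, ∑ t ∈ S, M c t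
      = ∑ g : F → F, (if univ.image g ⊆ S then (-1 : ℂ) ^ (Fintype.card F - S.card) else 0)
          * ∏ c, M c (g c) := by
    intro S
    rw [Finset.prod_univ_sum, Finset.mul_sum]
    simp only [ite_mul, zero_mul]
    rw [← Finset.sum_filter]
    refine Finset.sum_congr ?_ (fun _ _ => rfl)
    ext g
    simp [Finset.image_subset_iff]
  rw [Finset.sum_congr rfl (fun S _ => h1 S), Finset.sum_comm]
  simp only [← Finset.sum_mul, ryser_aux]
  simp only [ite_mul, one_mul, zero_mul]
  rw [← Finset.sum_filter]
  symm
  refine Finset.sum_bij (fun σ _ => (σ : F → F)) ?_ ?_ ?_ ?_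
  · intro σ _
    simp [Finset.image_univ_of_surjective σ.surjective]
  · intro a _ b _ h
    exact DFunLike.coe_injective h
  · intro g hg
    have hs : Function.Surjective g := by
      intro y
      have : y ∈ univ.image g := by rw [(Finset.mem_filter.1 hg).2]; simp
      simpa using this
    exact ⟨Equiv.ofBijective g (Finite.surjective_iff_bijective.1 hs), by simp, rfl⟩
  · intro σ _; rfl

theorem ep_eq (p : ℕ) [Fact p.Prime] (u : ZMod p) : ep p u = ZMod.stdAddChar u := by
  rw [ZMod.stdAddChar_apply, ZMod.toCircle_apply, ep]

theorem exists_char (F : Type*) [Field F] [Fintype F] (p : ℕ) [Fact p.Prime] [CharP F p] :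
    ∃ ψ : AddChar F ℂ, ψ.IsPrimitive ∧ ∀ x, ep p (absTrace p x) = ψ x := by
  letI := ZMod.algebra F p
  refine ⟨(ZMod.stdAddChar (N := p)).compAddMonoidHom
    (Algebra.trace (ZMod p) F).toAddMonoidHom, ?_, ?_⟩
  · apply AddChar.IsPrimitive.of_ne_one
    intro h
    have htr := (traceForm_nondegenerate (ZMod p) F).1 1
    apply one_ne_zero (α := F)
    apply htr
    intro b
    rw [Algebra.traceForm_apply, one_mul]
    have hb := DFunLike.congr_fun h b
    rw [AddChar.compAddMonoidHom_apply, AddChar.one_apply,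
      ← (ZMod.stdAddChar (N := p)).map_zero_eq_one] at hb
    exact ZMod.injective_stdAddChar hb
  · intro x
    rw [ep_eq]
    rfl

theorem my_coeff {F : Type*} [Field F] (c : F) (n k : ℕ) :
    ((X - C c) ^ n).coeff k = (-c) ^ (n - k) * (n.choose k : F) := by
  rw [sub_eq_add_neg, ← Polynomial.C_neg, Polynomial.coeff_X_add_C_pow]

theorem addChar_sum {F ι : Type*} [Field F] [DecidableEq ι] (ψ : AddChar F ℂ) (s : Finset ι)
    (f : ι → F) : ψ (∑ i ∈ s, f i) = ∏ i ∈ s, ψ (f i) := by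
  induction s using Finset.induction_on with
  | empty => simp
  | insert a s ha ih =>
    rw [Finset.sum_insert ha, Finset.prod_insert ha, AddChar.map_add_eq_mul, ih]

theorem permPoly_coeff {F : Type*} [Field F] [Fintype F] (hq2 : 2 < Fintype.card F)
    (σ : Equiv.Perm F) :
    (permPoly σ).degree < ((Fintype.card F - 2 : ℕ) : WithBot ℕ) ↔ ∑ c, c * σ c = 0 := by
  obtain ⟨n, hn⟩ : ∃ n, Fintype.card F = n + 3 := ⟨Fintype.card F - 3, by omega⟩
  have e1 : Fintype.card F - 1 = n + 2 := by omega
  have e2 : Fintype.card F - 2 = n + 1 := by omega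
  have hF : (n : F) + 3 = 0 := by
    have := Nat.cast_card_eq_zero F
    rw [hn] at this
    exact_mod_cast this
  have hmon : ∀ c : F, ((X - C c) ^ (n + 2)).coeff (n + 2) = 1 := by
    intro c
    rw [my_coeff]; simp
  have hco : ∀ c : F, ((X - C c) ^ (n + 2)).coeff (n + 1) = c := by
    intro c
    rw [my_coeff]
    have : (n + 2).choose (n + 1) = n + 2 := Nat.choose_succ_self_right (n + 1)
    rw [this]
    simp
    linear_combination (-c) * hF
  have hsum : ∑ c, σ c = 0 := by
    rw [Equiv.sum_comp σ (fun x => x)]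
    have := FiniteField.sum_pow_lt_card_sub_one F 1 (by omega)
    simpa using this
  have c1 : (permPoly σ).coeff (n + 1) = - ∑ c, c * σ c := by
    unfold permPoly
    rw [e1, Polynomial.finsetSum_coeff, ← Finset.sum_neg_distrib]
    refine Finset.sum_congr rfl fun c _ => ?_
    rw [Polynomial.coeff_C_mul, Polynomial.coeff_sub, hco, Polynomial.coeff_one]
    simp [mul_comm]
  have c2 : (permPoly σ).coeff (n + 2) = 0 := by
    unfold permPoly
    rw [e1, Polynomial.finsetSum_coeff, ← neg_eq_zero, ← hsum, ← Finset.sum_neg_distrib]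
    refine Finset.sum_congr rfl fun c _ => ?_
    rw [Polynomial.coeff_C_mul, Polynomial.coeff_sub, hmon, Polynomial.coeff_one]
    simp
  have c3 : ∀ m, n + 2 < m → (permPoly σ).coeff m = 0 := by
    intro m hm
    unfold permPoly
    rw [e1, Polynomial.finsetSum_coeff]
    refine Finset.sum_eq_zero fun c _ => ?_
    rw [Polynomial.coeff_C_mul, Polynomial.coeff_sub, my_coeff,
      Polynomial.coeff_one, Nat.choose_eq_zero_of_lt hm, if_neg (by omega)]
    simp
  rw [e2, Polynomial.degree_lt_iff_coeff_zero]
  constructor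
  · intro h
    have := h (n + 1) le_rfl
    rw [c1] at this
    exact neg_eq_zero.1 this
  · intro h m hm
    rcases Nat.lt_or_ge (n + 2) m with h' | h'
    · exact c3 m h'
    · rcases (by omega : m = n + 1 ∨ m = n + 2) with rfl | rfl
      · rw [c1, h, neg_zero]
      · exact c2

end helpers

theorem N_sub_factorial_eq (F : Type*) [Field F] [Fintype F] [DecidableEq F]
    (p : ℕ) [Fact p.Prime] [CharP F p]
    (q : ℕ) (hq : q = Fintype.card F) (hq2 : 2 < q)
    (N : ℕ)
    (hN : N = Nat.card {σ : Equiv.Perm F // (permPoly σ).degree < ((q - 2 : ℕ) : WithBot ℕ)}) :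
    (N : ℂ) - ((q - 1).factorial : ℂ) =
      ((q : ℂ) - 1) / q * ∑ S : Finset F, (-1 : ℂ) ^ (q - S.card) * (S.card : ℂ) *
        ∏ b ∈ Finset.univ \ {(0 : F)}, ∑ t ∈ S, ep p (absTrace p (b * t)) := by
  obtain ⟨ψ, hψ, he⟩ := exists_char F p
  have hq0 : (q : ℂ) ≠ 0 := by exact_mod_cast (by omega : q ≠ 0)
  set A : ℂ := ∑ σ : Equiv.Perm F, ∏ c, ψ (c * σ c) with hA
  have hR : ∑ S : Finset F, (-1 : ℂ) ^ (q - S.card) * (S.card : ℂ) *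
        ∏ b ∈ Finset.univ \ {(0 : F)}, ∑ t ∈ S, ep p (absTrace p (b * t)) = A := by
    rw [hA, ← ryser (fun c t => ψ (c * t)), hq]
    refine Finset.sum_congr rfl fun S _ => ?_
    rw [mul_assoc]
    congr 1
    rw [← Finset.mul_prod_erase univ _ (Finset.mem_univ (0 : F)), Finset.sdiff_singleton_eq_erase]
    simp [he]
  rw [hR]
  have hN' : (N : ℂ) = ∑ σ : Equiv.Perm F, if ∑ c, c * σ c = 0 then (1 : ℂ) else 0 := by
    rw [hN, hq, Finset.sum_boole, Nat.card_eq_fintype_card, Fintype.card_subtype]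
    congr 2
    ext σ
    simp [permPoly_coeff (hq ▸ hq2)]
  have hqN : (q : ℂ) * N = ∑ a : F, ∑ σ : Equiv.Perm F, ψ (a * ∑ c, c * σ c) := by
    rw [hN', Finset.sum_comm, Finset.mul_sum]
    refine Finset.sum_congr rfl fun σ _ => ?_
    rw [AddChar.sum_mulShift _ hψ, hq]
    split_ifs <;> simp
  have ha : ∀ a ∈ univ.erase (0 : F), ∑ σ : Equiv.Perm F, ψ (a * ∑ c, c * σ c) = A := by
    intro a ha
    have ha0 : a ≠ 0 := Finset.ne_of_mem_erase ha
    rw [hA, ← Equiv.sum_comp (Equiv.mulLeft (Equiv.mulLeft₀ a ha0))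
      (fun σ : Equiv.Perm F => ∏ c, ψ (c * σ c))]
    refine Finset.sum_congr rfl fun σ _ => ?_
    rw [Finset.mul_sum, addChar_sum]
    refine Finset.prod_congr rfl fun c _ => ?_
    congr 1
    simp [Equiv.Perm.mul_apply]
    ring
  rw [← Finset.add_sum_erase univ _ (Finset.mem_univ (0 : F)), Finset.sum_congr rfl ha] at hqN
  have hf : (q.factorial : ℂ) = q * (q - 1).factorial := by
    exact_mod_cast (Nat.mul_factorial_pred (by omega)).symm
  simp only [zero_mul, AddChar.map_zero_eq_one, Finset.sum_const, Finset.card_univ,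
    Fintype.card_perm, Finset.card_erase_of_mem (Finset.mem_univ (0 : F)), ← hq, nsmul_eq_mul,
    mul_one, hf, Nat.cast_sub (by omega : 1 ≤ q), Nat.cast_one] at hqN
  field_simp
  linear_combination hqN
end
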